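/- Let n, n' be natural numbers and μ, m integers with |μ|, |m| ≤ min(n, n'). Then there exists a polynomial p with real coefficients such that for all β ∈ [0, π], d_n^{μm}(β) · d_{n'}^{μm}(β) = p(cos β), where d_n^{μm} is the Wigner d-function. (Consequently, Gauss–Legendre quadrature computes the integrals ∫_{Θ₁}^{Θ₂} d_n^{μm}(β) d_{n'}^{μm}(β) sin β dβ exactly.) -/

import Mathlib

open scoped Real

/-- The Wigner d-function d_n^{μm}(β). -/
noncomputable def wignerd (n : ℕ) (μ m : ℤ) (β : ℝ) : ℝ :=
  (-1 : ℝ) ^ (μ - m) * Real.sqrt ((2 * (n : ℝ) + 1) / 2) *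
    Real.sqrt ((((n : ℤ) + m).toNat.factorial * ((n : ℤ) - m).toNat.factorial *
      ((n : ℤ) + μ).toNat.factorial * ((n : ℤ) - μ).toNat.factorial : ℕ) : ℝ) *
    ∑ σ ∈ Finset.Icc (max 0 (m - μ)) (min ((n : ℤ) + m) ((n : ℤ) - μ)),
      ((-1 : ℝ) ^ σ * Real.cos (β / 2) ^ (2 * (n : ℤ) - 2 * σ + m - μ) *
        Real.sin (β / 2) ^ (2 * σ - m + μ)) /
      ((σ.toNat.factorial * ((n : ℤ) + m - σ).toNat.factorial *
        ((n : ℤ) - μ - σ).toNat.factorial * (μ - m + σ).toNat.factorial : ℕ) : ℝ)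

/-- Finite sums of polynomial expressions in `cos β` are polynomial expressions in `cos β`. -/
theorem exists_poly_cos_sum {ι : Type*} (s : Finset ι) (f : ι → ℝ → ℝ)
    (hf : ∀ i ∈ s, ∃ p : Polynomial ℝ, ∀ β, f i β = p.eval (Real.cos β)) :
    ∃ p : Polynomial ℝ, ∀ β, ∑ i ∈ s, f i β = p.eval (Real.cos β) := by
  choose! p hp using hf
  exact ⟨∑ i ∈ s, p i, fun β => by
    rw [Polynomial.eval_finsetSum]
    exact Finset.sum_congr rfl fun i hi => hp i hi β⟩

/-- Even powers of `cos (β / 2)` and `sin (β / 2)` are polynomials in `cos β`. -/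
theorem exists_poly_cos_half_zpow (c : ℝ) {a b a' b' : ℤ} (ha : 0 ≤ a) (hb : 0 ≤ b)
    (ha' : 0 ≤ a') (hb' : 0 ≤ b') (hcos : Even (a + a')) (hsin : Even (b + b')) :
    ∃ p : Polynomial ℝ, ∀ β : ℝ,
      c * (Real.cos (β / 2) ^ a * Real.cos (β / 2) ^ a') *
        (Real.sin (β / 2) ^ b * Real.sin (β / 2) ^ b') = p.eval (Real.cos β) := by
  lift a to ℕ using ha
  lift b to ℕ using hb
  lift a' to ℕ using ha'
  lift b' to ℕ using hb'
  obtain ⟨k, hk⟩ : Even (a + a') := by exact_mod_cast hcos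
  obtain ⟨l, hl⟩ : Even (b + b') := by exact_mod_cast hsin
  refine ⟨.C c * (.C (1 / 2) * (1 + .X)) ^ k * (.C (1 / 2) * (1 - .X)) ^ l, fun β => ?_⟩
  have hc : Real.cos (β / 2) ^ 2 = 1 / 2 * (1 + Real.cos β) := by
    rw [Real.cos_sq, mul_div_cancel₀ β two_ne_zero]; ring
  have hs : Real.sin (β / 2) ^ 2 = 1 / 2 * (1 - Real.cos β) := by
    rw [Real.sin_sq, hc]; ring
  simp only [zpow_natCast, ← pow_add, hk, hl, ← two_mul, pow_mul, hc, hs,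
    Polynomial.eval_mul, Polynomial.eval_pow, Polynomial.eval_add, Polynomial.eval_sub,
    Polynomial.eval_C, Polynomial.eval_X, Polynomial.eval_one]

/-- For |μ|, |m| ≤ min(n, n'), the product
d_n^{μm}(β) · d_{n'}^{μm}(β) is a polynomial in cos β on [0, π]. -/
theorem wignerd_prod_poly_cos (n n' : ℕ) (μ m : ℤ)
    (hμ : |μ| ≤ min (n : ℤ) (n' : ℤ)) (hm : |m| ≤ min (n : ℤ) (n' : ℤ)) :
    ∃ p : Polynomial ℝ, ∀ β ∈ Set.Icc (0 : ℝ) π,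
      wignerd n μ m β * wignerd n' μ m β = p.eval (Real.cos β) := by
  suffices h : ∃ p : Polynomial ℝ, ∀ β, wignerd n μ m β * wignerd n' μ m β =
      p.eval (Real.cos β) from h.imp fun p hp β _ => hp β
  simp only [wignerd, Finset.mul_sum, Finset.sum_mul]
  refine exists_poly_cos_sum _ _ fun τ hτ => exists_poly_cos_sum _ _ fun σ hσ => ?_
  simp only [Finset.mem_Icc, max_le_iff, le_min_iff] at hσ hτ
  have regroup : ∀ C x y z d C' x' y' z' d' : ℝ,
      C * (x * y * z / d) * (C' * (x' * y' * z' / d')) =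
        C * C' * (x / d * (x' / d')) * (y * y') * (z * z') := by
    intros; ring
  simp only [regroup]
  exact exists_poly_cos_half_zpow _ (by lia) (by lia) (by lia) (by lia)
    ⟨n + n' - σ - τ + m - μ, by ring⟩ ⟨σ + τ - m + μ, by ring⟩
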